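/- arXiv:1701.07667 — 2 statements merged into one kernel-verified Lean document; each statement's English description precedes it below -/
import Mathlib

section
/- Let n ≥ 4 be an even integer and let k = ⌊n/4⌋. Then there exists a set of functions from {-1,1}^n to {-1,1}, each locally (1/2)-biased and pairwise non-isomorphic, whose cardinality is at least the binomial coefficient C(2⌊√k⌋, ⌊√k⌋). -/
/-- A point of the Boolean hypercube `{-1,1}^n`, encoded inside `Fin n → ℤ`. -/
def IsPMOne {n : ℕ} (x : Fin n → ℤ) : Prop := ∀ i, x i = 1 ∨ x i = -1

/-- `f` is locally `p`-biased: it takes values in `{-1,1}` on the cube, and for every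
vertex `x` of the cube, exactly `p·n` of the `n` neighbors of `x` satisfy `f y = 1`. -/
def LocallyBiased (n : ℕ) (p : ℝ) (f : (Fin n → ℤ) → ℤ) : Prop :=
  (∀ x : Fin n → ℤ, IsPMOne x → (f x = 1 ∨ f x = -1)) ∧
  ∀ x : Fin n → ℤ, IsPMOne x →
    ((Finset.univ.filter fun i => f (Function.update x i (-(x i))) = 1).card : ℝ) = p * n

/-- `f` and `g` are isomorphic: some automorphism of the hypercube (a permutation of the
coordinates combined with sign flips of coordinates) maps one to the other. -/
def Isomorphic (n : ℕ) (f g : (Fin n → ℤ) → ℤ) : Prop :=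
  ∃ (π : Equiv.Perm (Fin n)) (ε : Fin n → ℤ), (∀ i, ε i = 1 ∨ ε i = -1) ∧
    ∀ x : Fin n → ℤ, IsPMOne x → g x = f (fun i => ε i * x (π i))

open Finset

namespace HalfBiased

/-- The point of the cube `ℤˣ^ι` obtained from `u` by negating the coordinate `i`. -/
def flip {ι : Type*} [DecidableEq ι] (u : ι → ℤˣ) (i : ι) : ι → ℤˣ :=
  Function.update u i (-(u i))

/-- `L` is, up to a sign, a character of the cube: negating a given coordinate multiplies
`L` by a constant. -/
def IsAffine {ι : Type*} [DecidableEq ι] (L : (ι → ℤˣ) → ℤˣ) : Prop :=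
  ∀ i, ∃ c : ℤˣ, ∀ u, L (flip u i) = c * L u

/-- The Hamming distance between two functions on the cube. -/
def dist {ι : Type*} [Fintype ι] [DecidableEq ι] (f g : (ι → ℤˣ) → ℤˣ) : ℕ :=
  #{u | f u ≠ g u}

section Cube

variable {ι : Type*} [DecidableEq ι]

theorem flip_flip (u : ι → ℤˣ) (i : ι) : flip (flip u i) i = u := by
  simp [flip]

theorem IsAffine.mul {L M : (ι → ℤˣ) → ℤˣ} (hL : IsAffine L) (hM : IsAffine M) :
    IsAffine (fun u => L u * M u) := by
  intro i
  obtain ⟨c, hc⟩ := hL i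
  obtain ⟨d, hd⟩ := hM i
  refine ⟨c * d, fun u => ?_⟩
  simp only [hc, hd]
  exact mul_mul_mul_comm _ _ _ _

variable [Fintype ι]

theorem eq_of_flip_invariant {L : (ι → ℤˣ) → ℤˣ} (h : ∀ i u, L (flip u i) = L u)
    (u v : ι → ℤˣ) : L u = L v := by
  have key : ∀ s : Finset ι, L (s.piecewise u v) = L v := by
    intro s
    induction s using Finset.induction_on with
    | empty => simp
    | insert j s _ ih =>
      rw [Finset.piecewise_insert, ← ih]
      by_cases hj : u j = s.piecewise u v j
      · rw [hj, Function.update_eq_self]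
      · rw [Int.units_ne_iff_eq_neg.mp hj]
        exact h j _
  simpa using key univ

/-- A non-constant signed character differs from `1` on exactly half of the cube. -/
theorem IsAffine.const_or_balanced {L : (ι → ℤˣ) → ℤˣ} (hL : IsAffine L) :
    (∀ u v, L u = L v) ∨ 2 * #{u | L u ≠ 1} = Fintype.card (ι → ℤˣ) := by
  by_cases h : ∀ i u, L (flip u i) = L u
  · exact Or.inl (eq_of_flip_invariant h)
  right
  push Not at h
  obtain ⟨i, w, hw⟩ := h
  obtain ⟨c, hc⟩ := hL i
  have hc1 : c = -1 := by
    rcases Int.units_eq_one_or c with rfl | rfl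
    · exact absurd (by simpa using hc w) hw
    · rfl
  subst hc1
  have e : #{u | L u ≠ 1} = #{u | L u = 1} := by
    refine Finset.card_nbij' (flip · i) (flip · i) ?_ ?_ ?_ ?_
    · intro u hu
      simp only [mem_coe, mem_filter, mem_univ, true_and] at hu ⊢
      rw [hc, Int.units_ne_iff_eq_neg.mp hu]
      rfl
    · intro u hu
      simp only [mem_coe, mem_filter, mem_univ, true_and] at hu ⊢
      rw [hc, hu]
      decide
    · intro u _
      exact flip_flip u i
    · intro u _
      exact flip_flip u i
  have t := Finset.card_filter_add_card_filter_not (s := (univ : Finset (ι → ℤˣ)))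
    (fun u => L u = 1)
  rw [Finset.card_univ] at t
  simp only [ne_eq] at e ⊢
  omega

/-- Within a quarter of the size of the cube, the nearest signed character is unique. -/
theorem dist_le_of_isAffine {f L₀ L : (ι → ℤˣ) → ℤˣ} (h₀ : IsAffine L₀) (hL : IsAffine L)
    (hd : 4 * dist f L₀ ≤ Fintype.card (ι → ℤˣ)) : dist f L₀ ≤ dist f L := by
  rcases (h₀.mul hL).const_or_balanced with h | h
  · have hc : ∀ u, L₀ u * L u = L₀ 1 * L 1 := fun u => h u 1
    rcases Int.units_eq_one_or (L₀ 1 * L 1) with h1 | h1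
    · have : L₀ = L := by
        funext u
        have := hc u
        rw [h1, mul_eq_one_iff_eq_inv, Int.units_inv_eq_self] at this
        exact this
      rw [this]
    · have t := Finset.card_filter_add_card_filter_not (s := (univ : Finset (ι → ℤˣ)))
        (fun u => f u ≠ L₀ u)
      rw [Finset.card_univ] at t
      have : #{u | ¬ f u ≠ L₀ u} ≤ dist f L := by
        refine Finset.card_le_card fun u hu => ?_
        simp only [mem_filter, mem_univ, true_and, not_not] at hu ⊢
        intro hf
        have := hc u
        rw [← hu, ← hf, h1, Int.units_mul_self] at this
        exact absurd this (by decide)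
      unfold dist at *
      omega
  · have : #{u | L₀ u * L u ≠ 1} ≤ dist f L₀ + dist f L := by
      refine (Finset.card_le_card fun u hu => ?_).trans (Finset.card_union_le _ _)
      simp only [mem_filter, mem_univ, true_and, mem_union] at hu ⊢
      by_contra! hf
      rw [← hf.1, ← hf.2, Int.units_mul_self] at hu
      exact hu rfl
    omega

end Cube

section Pairs

variable {ι m : Type*}

/-- The products of the two coordinates in each pair, for a pairing `e` of the coordinates. -/
def pairProd (e : ι ≃ m × Bool) (u : ι → ℤˣ) (j : m) : ℤˣ :=
  u (e.symm (j, true)) * u (e.symm (j, false))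

/-- The other coordinate of the pair containing a given one. -/
def partner (e : ι ≃ m × Bool) (i : ι) : ι := e.symm ((e i).1, !(e i).2)

theorem partner_partner (e : ι ≃ m × Bool) (i : ι) : partner e (partner e i) = i := by
  simp [partner]

variable [DecidableEq ι] [DecidableEq m]

theorem flip_symm_apply (e : ι ≃ m × Bool) (u : ι → ℤˣ) (i : ι) (p : m × Bool) :
    flip u i (e.symm p) = if p = e i then -u (e.symm p) else u (e.symm p) := by
  by_cases h : p = e i
  · subst h
    simp [flip]
  · rw [if_neg h, flip, Function.update_of_ne]
    rintro rfl
    simp at h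

theorem pairProd_flip (e : ι ≃ m × Bool) (u : ι → ℤˣ) (i : ι) :
    pairProd e (flip u i) = fun j => if j = (e i).1 then -pairProd e u j else pairProd e u j := by
  funext j
  obtain ⟨⟨j', b⟩, rfl⟩ := e.symm.surjective i
  simp only [pairProd, flip_symm_apply, Equiv.apply_symm_apply, Prod.mk.injEq]
  by_cases h : j = j' <;> cases b <;> simp [h]

variable [Fintype m]

/-- The product of the first coordinates of all pairs. -/
def firstProd (e : ι ≃ m × Bool) (u : ι → ℤˣ) : ℤˣ :=
  ∏ j, u (e.symm (j, true))

/-- The character `firstProd e`, negated where the vector of pair products lies in `W`. -/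
def twist (e : ι ≃ m × Bool) (W : Finset (m → ℤˣ)) (u : ι → ℤˣ) : ℤˣ :=
  if pairProd e u ∈ W then -firstProd e u else firstProd e u

theorem firstProd_flip (e : ι ≃ m × Bool) (u : ι → ℤˣ) (i : ι) :
    firstProd e (flip u i) = (if (e i).2 then -1 else 1) * firstProd e u := by
  obtain ⟨⟨j', b⟩, rfl⟩ := e.symm.surjective i
  have : ∀ j, flip u (e.symm (j', b)) (e.symm (j, true)) =
      (if j = j' then (if b then -1 else 1) else 1) * u (e.symm (j, true)) := by
    intro j
    rw [flip_symm_apply]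
    by_cases h : j = j' <;> cases b <;> simp [h]
  simp only [firstProd, this, Finset.prod_mul_distrib]
  simp

theorem isAffine_firstProd (e : ι ≃ m × Bool) : IsAffine (firstProd e) :=
  fun i => ⟨_, fun u => firstProd_flip e u i⟩

theorem twist_flip_partner (e : ι ≃ m × Bool) (W : Finset (m → ℤˣ)) (u : ι → ℤˣ) (i : ι) :
    twist e W (flip u (partner e i)) = -twist e W (flip u i) := by
  have h1 : pairProd e (flip u (partner e i)) = pairProd e (flip u i) := by
    simp [pairProd_flip, partner]
  have h2 : firstProd e (flip u (partner e i)) = -firstProd e (flip u i) := by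
    rw [firstProd_flip, firstProd_flip]
    cases h : (e i).2 <;> simp [partner, h]
  unfold twist
  rw [h1, h2]
  split_ifs <;> rfl

variable [Fintype ι]

theorem two_mul_card_twist_flip (e : ι ≃ m × Bool) (W : Finset (m → ℤˣ)) (u : ι → ℤˣ) :
    2 * #{i | twist e W (flip u i) = 1} = Fintype.card ι := by
  have h : #{i | twist e W (flip u i) = 1} = #{i | ¬ twist e W (flip u i) = 1} := by
    refine Finset.card_nbij' (partner e) (partner e) ?_ ?_ ?_ ?_
    · intro i hi
      simp only [mem_coe, mem_filter, mem_univ, true_and] at hi ⊢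
      rw [twist_flip_partner, hi]
      decide
    · intro i hi
      simp only [mem_coe, mem_filter, mem_univ, true_and] at hi ⊢
      rw [twist_flip_partner, Int.units_ne_iff_eq_neg.mp hi]
      rfl
    · intro i _
      exact partner_partner e i
    · intro i _
      exact partner_partner e i
  have t := Finset.card_filter_add_card_filter_not (s := (univ : Finset ι))
    (fun i => twist e W (flip u i) = 1)
  rw [Finset.card_univ] at t
  omega

theorem dist_twist_firstProd (e : ι ≃ m × Bool) (W : Finset (m → ℤˣ)) :
    dist (twist e W) (firstProd e) = #W * 2 ^ Fintype.card m := by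
  have hcard : Fintype.card (m → ℤˣ) = 2 ^ Fintype.card m := by simp
  rw [← hcard, ← Finset.card_univ, ← Finset.card_product, dist]
  refine Finset.card_nbij' (fun u => (pairProd e u, fun j => u (e.symm (j, true))))
    (fun p i => if (e i).2 then p.2 (e i).1 else p.2 (e i).1 * p.1 (e i).1) ?_ ?_ ?_ ?_
  · intro u hu
    simp only [mem_coe, mem_filter, mem_univ, true_and] at hu
    unfold twist at hu
    split_ifs at hu with h
    · simpa using h
    · exact absurd rfl hu
  · rintro ⟨z, a⟩ hz
    have hzW : z ∈ W := by simpa using hz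
    have : pairProd e (fun i => if (e i).2 then a (e i).1 else a (e i).1 * z (e i).1) = z := by
      funext j
      simp [pairProd, ← mul_assoc]
    simp only [mem_coe, mem_filter, mem_univ, true_and]
    rw [twist, this, if_pos hzW]
    exact Int.units_ne_iff_eq_neg.mpr rfl
  · intro u _
    funext i
    obtain ⟨⟨j, b⟩, rfl⟩ := e.symm.surjective i
    cases b <;> simp [pairProd, ← mul_assoc]
  · rintro ⟨z, a⟩ _
    ext j <;> simp [pairProd, ← mul_assoc]

end Pairs

section Integer

variable {n : ℕ}

/-- The integer point of the cube given by a vector of units. -/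
def toInt (u : Fin n → ℤˣ) : Fin n → ℤ := fun i => (u i : ℤ)

/-- A function on vectors of units, viewed as a function of integer vectors. -/
def ofUnits (f : (Fin n → ℤˣ) → ℤˣ) (x : Fin n → ℤ) : ℤ :=
  f (fun i => if x i = 1 then 1 else -1)

theorem isPMOne_toInt (u : Fin n → ℤˣ) : IsPMOne (toInt u) := fun i => by
  rcases Int.units_eq_one_or (u i) with h | h <;> simp [toInt, h]

theorem exists_toInt {x : Fin n → ℤ} (hx : IsPMOne x) : ∃ u, toInt u = x := by
  refine ⟨fun i => if x i = 1 then 1 else -1, funext fun i => ?_⟩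
  rcases hx i with h | h <;> simp [toInt, h]

theorem ofUnits_toInt (f : (Fin n → ℤˣ) → ℤˣ) (u : Fin n → ℤˣ) :
    ofUnits f (toInt u) = f u := by
  have : (fun i => if toInt u i = 1 then (1 : ℤˣ) else -1) = u := by
    funext i
    rcases Int.units_eq_one_or (u i) with h | h <;> simp [toInt, h]
  rw [ofUnits, this]

theorem toInt_flip (u : Fin n → ℤˣ) (i : Fin n) :
    Function.update (toInt u) i (-(toInt u i)) = toInt (flip u i) := by
  funext j
  by_cases h : j = i
  · subst h
    simp [toInt, flip]
  · simp [toInt, flip, h]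

theorem locallyBiased_ofUnits {f : (Fin n → ℤˣ) → ℤˣ}
    (hf : ∀ u, 2 * #{i | f (flip u i) = 1} = n) : LocallyBiased n (1 / 2) (ofUnits f) := by
  constructor
  · intro x _
    rcases Int.units_eq_one_or (f fun i => if x i = 1 then 1 else -1) with h | h <;>
      simp [ofUnits, h]
  · intro x hx
    obtain ⟨u, rfl⟩ := exists_toInt hx
    have := hf u
    simp only [toInt_flip, ofUnits_toInt, Units.val_eq_one]
    rw [← @Nat.cast_inj ℝ] at this
    push_cast at this
    linarith

theorem isomorphic_refl (f : (Fin n → ℤ) → ℤ) : Isomorphic n f f :=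
  ⟨1, fun _ => 1, fun _ => Or.inl rfl, fun x _ => by simp⟩

/-- An isomorphism between functions on the cube cannot increase the distance to the set of
signed characters. -/
theorem exists_isAffine_dist_eq {f g : (Fin n → ℤˣ) → ℤˣ}
    (h : Isomorphic n (ofUnits f) (ofUnits g)) {L : (Fin n → ℤˣ) → ℤˣ} (hL : IsAffine L) :
    ∃ M, IsAffine M ∧ dist g M = dist f L := by
  obtain ⟨π, ε, hε, h⟩ := h
  obtain ⟨δ, rfl⟩ := exists_toInt hε
  let T : (Fin n → ℤˣ) ≃ (Fin n → ℤˣ) :=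
    { toFun := fun u i => δ i * u (π i)
      invFun := fun v j => δ (π.symm j) * v (π.symm j)
      left_inv := fun u => by funext j; simp [← mul_assoc]
      right_inv := fun v => by funext j; simp [← mul_assoc] }
  have hT : ∀ u, g u = f (T u) := by
    intro u
    have := h (toInt u) (isPMOne_toInt u)
    have e : (fun i => toInt δ i * toInt u (π i)) = toInt (T u) := by
      funext i
      simp [toInt, T]
    rw [e, ofUnits_toInt, ofUnits_toInt] at this
    exact Units.ext this
  refine ⟨L ∘ T, fun i => ?_, ?_⟩
  · obtain ⟨c, hc⟩ := hL (π.symm i)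
    refine ⟨c, fun u => ?_⟩
    have : T (flip u i) = flip (T u) (π.symm i) := by
      funext k
      by_cases hk : k = π.symm i
      · subst hk
        simp [T, flip]
      · have : π k ≠ i := fun e => hk (by simp [← e])
        simp [T, flip, hk, this]
    simp only [Function.comp_apply, this, hc]
  · refine Finset.card_equiv T fun u => ?_
    simp [hT]

theorem Isomorphic.symm_ofUnits {f g : (Fin n → ℤˣ) → ℤˣ}
    (h : Isomorphic n (ofUnits f) (ofUnits g)) : Isomorphic n (ofUnits g) (ofUnits f) := by
  obtain ⟨π, ε, hε, h⟩ := h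
  refine ⟨π.symm, fun i => ε (π.symm i), fun i => hε _, fun x hx => ?_⟩
  rw [h]
  · congr 1
    funext i
    rcases hε i with e | e <;> simp [e]
  · intro i
    rcases hε (π.symm i) with e | e <;> rcases hx (π.symm i) with e' | e' <;> simp [e, e']

theorem dist_le_of_isomorphic {f g L : (Fin n → ℤˣ) → ℤˣ} (hL : IsAffine L)
    (hg : 4 * dist g L ≤ Fintype.card (Fin n → ℤˣ))
    (h : Isomorphic n (ofUnits f) (ofUnits g)) : dist g L ≤ dist f L := by
  obtain ⟨M, hM, e⟩ := exists_isAffine_dist_eq h hL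
  exact (dist_le_of_isAffine hL hM hg).trans e.le

end Integer

theorem choose_two_mul_self_le {s m : ℕ} (hm : 2 ≤ m) (hs : 2 * (s * s) ≤ m) :
    Nat.choose (2 * s) s ≤ 2 ^ (m - 2) + 1 := by
  rcases Nat.lt_or_ge s 2 with h | h
  · have := Nat.one_le_two_pow (n := m - 2)
    interval_cases s
    · simp
    · simpa using this
  · have h1 : Nat.choose (2 * s) s ≤ 2 ^ (2 * s) := Nat.choose_le_two_pow _ _
    have h2 : 2 ^ (2 * s) ≤ 2 ^ (m - 2) := by
      refine Nat.pow_le_pow_right (by norm_num) ?_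
      have : 2 * s ≤ s * s := Nat.mul_le_mul_right s h
      omega
    omega

end HalfBiased

open HalfBiased in
theorem stmt_9 (n : ℕ) (hn : 4 ≤ n) (hev : Even n) (k : ℕ) (hk : k = n / 4) :
    ∃ F : Set ((Fin n → ℤ) → ℤ),
      (∀ f ∈ F, LocallyBiased n (1 / 2) f) ∧
      (∀ f ∈ F, ∀ g ∈ F, f ≠ g → ¬ Isomorphic n f g) ∧
      Nat.choose (2 * Nat.sqrt k) (Nat.sqrt k) ≤ F.ncard := by
  obtain ⟨m, hm⟩ := hev
  have e : Fin n ≃ Fin m × Bool := Fintype.equivOfCardEq (by simp; omega)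
  have hpow : (2 : ℕ) ^ m = 2 ^ (m - 2) * 4 := by
    rw [show m = m - 2 + 2 by omega, pow_add]
    simp
  have hW : ∀ w : Fin (2 ^ (m - 2) + 1), ∃ W : Finset (Fin m → ℤˣ), #W = w := by
    intro w
    obtain ⟨W, -, hW⟩ := Finset.exists_subset_card_eq (s := (univ : Finset (Fin m → ℤˣ)))
      (n := w) (by
        have := w.isLt
        simp only [Finset.card_univ, Fintype.card_pi, Fintype.card_units_int, Finset.prod_const,
          Fintype.card_fin]
        omega)
    exact ⟨W, hW⟩
  choose W hW using hW
  have hdist : ∀ w, dist (twist e (W w)) (firstProd e) = w * 2 ^ m := by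
    intro w
    rw [dist_twist_firstProd, hW, Fintype.card_fin]
  have hsmall : ∀ w, 4 * dist (twist e (W w)) (firstProd e) ≤ Fintype.card (Fin n → ℤˣ) := by
    intro w
    have h4 : 4 * (w : ℕ) ≤ 2 ^ m := by
      have := w.isLt
      omega
    rw [hdist, ← mul_assoc]
    simpa [hm, pow_add] using Nat.mul_le_mul_right (2 ^ m) h4
  have hle : ∀ v w, Isomorphic n (ofUnits (twist e (W v))) (ofUnits (twist e (W w))) →
      w ≤ v := by
    intro v w h
    have := dist_le_of_isomorphic (isAffine_firstProd e) (hsmall w) h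
    rw [hdist, hdist] at this
    exact Fin.le_def.mpr (Nat.le_of_mul_le_mul_right this (by positivity))
  have heq : ∀ v w, Isomorphic n (ofUnits (twist e (W v))) (ofUnits (twist e (W w))) →
      v = w := fun v w h => le_antisymm (hle w v (Isomorphic.symm_ofUnits h)) (hle v w h)
  refine ⟨Set.range fun w => ofUnits (twist e (W w)), ?_, ?_, ?_⟩
  · rintro _ ⟨w, rfl⟩
    exact locallyBiased_ofUnits fun u => by
      simpa using two_mul_card_twist_flip e (W w) u
  · rintro _ ⟨v, rfl⟩ _ ⟨w, rfl⟩ hne h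
    exact hne (by rw [heq v w h])
  · have hinj : Function.Injective fun w => ofUnits (twist e (W w)) := by
      intro v w h
      refine heq v w ?_
      simp only at h
      rw [h]
      exact isomorphic_refl _
    rw [Set.ncard_range_of_injective hinj, Nat.card_fin]
    have := Nat.sqrt_le k
    exact choose_two_mul_self_le (by omega) (by omega)
end

section
/- For every integer n ≥ 5, there exist two non-isomorphic locally ((n−3)/n)-stable functions f, g : {-1,1}^n → {-1,1}; that is, every point of {-1,1}^n has exactly n − 3 neighbors on which f takes the same value (and likewise for g), and no permutation of coordinates combined with sign flips of coordinates maps f to g. -/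
/-- Extend a function of five variables to a function on `Fin (m + 5) → ℤ`. -/
def liftFive {m : ℕ} (F : ℤ → ℤ → ℤ → ℤ → ℤ → ℤ) (x : Fin (m + 5) → ℤ) : ℤ :=
  F (x 0) (x 1) (x 2) (x 3) (x 4)

/-- The locally stable function on five variables which is not a product of coordinates. -/
def selector (a b c d e : ℤ) : ℤ := if a = c then e * (b * a) else e * (d * c)

/-- A coordinate flip leaves `liftFive F` unchanged for each of the last `m` coordinates, so only
the first five have to be counted. -/
theorem card_stable_liftFive {m : ℕ} (F : ℤ → ℤ → ℤ → ℤ → ℤ → ℤ) (x : Fin (m + 5) → ℤ) :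
    (Finset.univ.filter fun i =>
      liftFive F (Function.update x i (-(x i))) = liftFive F x).card =
    (if F (-x 0) (x 1) (x 2) (x 3) (x 4) = liftFive F x then 1 else 0) +
    ((if F (x 0) (-x 1) (x 2) (x 3) (x 4) = liftFive F x then 1 else 0) +
    ((if F (x 0) (x 1) (-x 2) (x 3) (x 4) = liftFive F x then 1 else 0) +
    ((if F (x 0) (x 1) (x 2) (-x 3) (x 4) = liftFive F x then 1 else 0) +
    ((if F (x 0) (x 1) (x 2) (x 3) (-x 4) = liftFive F x then 1 else 0) + m)))) := by
  have h1 : (1 : Fin (m + 5)) = Fin.succ 0 := rfl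
  have h2 : (2 : Fin (m + 5)) = Fin.succ (Fin.succ 0) := rfl
  have h3 : (3 : Fin (m + 5)) = Fin.succ (Fin.succ (Fin.succ 0)) := rfl
  have h4 : (4 : Fin (m + 5)) = Fin.succ (Fin.succ (Fin.succ (Fin.succ 0))) := rfl
  rw [Finset.card_filter]
  simp only [Fin.sum_univ_succ, liftFive, h1, h2, h3, h4, Function.update_apply, Fin.succ_inj,
    Fin.succ_ne_zero, (Fin.succ_ne_zero _).symm, if_true, if_false]
  simp

theorem stmt_16 (n : ℕ) (hn : 5 ≤ n) :
    ∃ f g : (Fin n → ℤ) → ℤ,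
      (∀ x : Fin n → ℤ, IsPMOne x → (f x = 1 ∨ f x = -1)) ∧
      (∀ x : Fin n → ℤ, IsPMOne x → (g x = 1 ∨ g x = -1)) ∧
      -- `f` and `g` are locally `(n-3)/n`-stable
      (∀ x : Fin n → ℤ, IsPMOne x →
        (Finset.univ.filter fun i => f (Function.update x i (-(x i))) = f x).card = n - 3) ∧
      (∀ x : Fin n → ℤ, IsPMOne x →
        (Finset.univ.filter fun i => g (Function.update x i (-(x i))) = g x).card = n - 3) ∧
      ¬ Isomorphic n f g := by
  obtain ⟨m, rfl⟩ := Nat.exists_eq_add_of_le' hn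
  refine ⟨liftFive fun a b c _ _ => a * b * c, liftFive selector, ?_, ?_, ?_, ?_, ?_⟩
  · intro x hx
    rcases hx 0 with h0 | h0 <;> rcases hx 1 with h1 | h1 <;> rcases hx 2 with h2 | h2 <;>
      simp [liftFive, h0, h1, h2]
  · intro x hx
    rcases hx 0 with h0 | h0 <;> rcases hx 1 with h1 | h1 <;> rcases hx 2 with h2 | h2 <;>
      rcases hx 3 with h3 | h3 <;> rcases hx 4 with h4 | h4 <;>
      simp [liftFive, selector, h0, h1, h2, h3, h4]
  · intro x hx
    rw [card_stable_liftFive]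
    rcases hx 0 with h0 | h0 <;> rcases hx 1 with h1 | h1 <;> rcases hx 2 with h2 | h2 <;>
      simp [liftFive, h0, h1, h2] <;> omega
  · intro x hx
    rw [card_stable_liftFive]
    rcases hx 0 with h0 | h0 <;> rcases hx 1 with h1 | h1 <;> rcases hx 2 with h2 | h2 <;>
      rcases hx 3 with h3 | h3 <;> rcases hx 4 with h4 | h4 <;>
      simp [liftFive, selector, h0, h1, h2, h3, h4] <;> omega
  · rintro ⟨π, ε, -, h⟩
    let X : ℤ → ℤ → Fin (m + 5) → ℤ := fun s t i =>
      (if i = 0 then s else 1) * (if i = 1 then t else 1)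
    have hX : ∀ s t : ℤ, (s = 1 ∨ s = -1) → (t = 1 ∨ t = -1) → IsPMOne (X s t) := by
      rintro s t (rfl | rfl) (rfl | rfl) i <;> dsimp only [X] <;> split_ifs <;> simp
    -- A product of coordinates is multiplicative, unlike `selector`.
    have hmul : liftFive selector (X (-1) (-1)) * liftFive selector (X 1 1) =
        liftFive selector (X (-1) 1) * liftFive selector (X 1 (-1)) := by
      rw [h _ (hX _ _ (by simp) (by simp)), h _ (hX _ _ (by simp) (by simp)),
        h _ (hX _ _ (by simp) (by simp)), h _ (hX _ _ (by simp) (by simp))]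
      simp only [liftFive, X, ite_self, mul_one, one_mul]
      ring
    have ne_of_two_le : ∀ k : Fin (m + 3), k.succ.succ ≠ 0 ∧ k.succ.succ ≠ 1 := fun k =>
      ⟨Fin.succ_ne_zero _, fun hk => Fin.succ_ne_zero k (Fin.succ_injective _ hk)⟩
    have n1 : (1 : Fin (m + 5)) ≠ 0 := by simp
    have n2 : (2 : Fin (m + 5)) ≠ 0 ∧ (2 : Fin (m + 5)) ≠ 1 := ne_of_two_le 0
    have n3 : (3 : Fin (m + 5)) ≠ 0 ∧ (3 : Fin (m + 5)) ≠ 1 := ne_of_two_le 1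
    have n4 : (4 : Fin (m + 5)) ≠ 0 ∧ (4 : Fin (m + 5)) ≠ 1 := ne_of_two_le 2
    simp only [X, liftFive, selector, n1, n1.symm, n2, n3, n4, if_true, if_false] at hmul
    norm_num at hmul
end
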